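/- arXiv:2311.03548 — 4 statements merged into one kernel-verified Lean document; each statement's English description precedes it below -/
import Mathlib

section
/- Let f = (f₁, f₂) : (ℂ²,0) → (ℂ²,0) be a holomorphic map germ, let Δ be the determinant of its Jacobian matrix, and suppose both ideals ⟨Δ, det(df₁,dΔ)⟩ and J(f,Δ) (generated by the 2×2 minors of the Jacobian of (f₁,f₂,Δ) : ℂ² → ℂ³) have finite colength in O₂, and suppose f₁ has an isolated singularity. Then there is a short exact sequence of ℂ-vector spaces 0 → O₂/Jf₁ → O₂/⟨Δ, det(df₁,dΔ)⟩ → O₂/J(f,Δ) → 0, where the first map is multiplication by det(df₂,dΔ) and the second is the natural projection. -/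
/-!  STATEMENT 1 (the Gaffney–Mond exact sequence).  `O₂ = MvPowerSeries (Fin 2) ℂ`,
`pd i` is the partial derivative, `det2 g h = det(dg, dh)` is the Jacobian
determinant of the pair `(g, h)`.  For `f = (f₁, f₂)` with Jacobian determinant
`Δ`, the sequence
`0 → O₂/Jf₁ →^{·det(df₂,dΔ)} O₂/⟨Δ, det(df₁,dΔ)⟩ →^{π} O₂/J(f,Δ) → 0`
is exact; exactness is expressed through the induced map
`ψ' : O₂ → O₂/⟨Δ, det(df₁,dΔ)⟩`, `a ↦ det(df₂,dΔ)·a mod ⟨Δ, det(df₁,dΔ)⟩`. -/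

noncomputable def pd (i : Fin 2) (f : MvPowerSeries (Fin 2) ℂ) :
    MvPowerSeries (Fin 2) ℂ :=
  fun m => ((m i : ℂ) + 1) * f (m + Finsupp.single i 1)

/-- `det2 g h = det(dg, dh)`, the determinant with rows the gradients of `g`, `h`. -/
noncomputable def det2 (g h : MvPowerSeries (Fin 2) ℂ) : MvPowerSeries (Fin 2) ℂ :=
  pd 0 g * pd 1 h - pd 1 g * pd 0 h

lemma X_pow_mem_of_fin (I : Ideal (MvPowerSeries (Fin 2) ℂ))
    (hI : FiniteDimensional ℂ (MvPowerSeries (Fin 2) ℂ ⧸ I)) (i : Fin 2) :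
    ∃ k : ℕ, (MvPowerSeries.X i : MvPowerSeries (Fin 2) ℂ) ^ k ∈ I := by
  obtain ⟨p, hp, hp0⟩ := Algebra.IsIntegral.isIntegral (R := ℂ)
    (Ideal.Quotient.mk I (MvPowerSeries.X i))
  obtain ⟨q, hq, hnd⟩ := Polynomial.exists_eq_pow_rootMultiplicity_mul_and_not_dvd p hp.ne_zero 0
  generalize Polynomial.rootMultiplicity 0 p = k at hq
  refine ⟨k, ?_⟩
  have h1 : Polynomial.aeval (MvPowerSeries.X i : MvPowerSeries (Fin 2) ℂ) p ∈ I := by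
    rw [← Ideal.Quotient.eq_zero_iff_mem]
    have := Polynomial.aeval_algHom_apply (Ideal.Quotient.mkₐ ℂ I)
      (MvPowerSeries.X i : MvPowerSeries (Fin 2) ℂ) p
    simp only [Ideal.Quotient.mkₐ_eq_mk] at this
    rw [← this]
    exact hp0
  have hu : IsUnit (Polynomial.aeval (MvPowerSeries.X i : MvPowerSeries (Fin 2) ℂ) q) := by
    rw [MvPowerSeries.isUnit_iff_constantCoeff, isUnit_iff_ne_zero]
    intro h0
    apply hnd
    rw [Polynomial.dvd_iff_isRoot, Polynomial.IsRoot]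
    rw [Polynomial.aeval_def, Polynomial.hom_eval₂] at h0
    have : (MvPowerSeries.constantCoeff (σ := Fin 2) (R := ℂ)).comp
        (algebraMap ℂ (MvPowerSeries (Fin 2) ℂ)) = RingHom.id ℂ := by
      ext x; simp [MvPowerSeries.algebraMap_apply]
    rw [this, MvPowerSeries.constantCoeff_X] at h0
    exact h0
  rw [hq] at h1
  simp only [map_zero, sub_zero, map_mul, map_pow, Polynomial.aeval_X] at h1
  exact (Ideal.mul_unit_mem_iff_mem I hu).mp h1

lemma X_pow_dvd_aux (k l : ℕ) (s t : MvPowerSeries (Fin 2) ℂ)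
    (h : MvPowerSeries.X 1 ^ l * s = MvPowerSeries.X 0 ^ k * t) :
    (MvPowerSeries.X 0 : MvPowerSeries (Fin 2) ℂ) ^ k ∣ s := by
  have h1 : (MvPowerSeries.X 0 : MvPowerSeries (Fin 2) ℂ) ^ k ∣ MvPowerSeries.X 1 ^ l * s :=
    ⟨t, h⟩
  rw [MvPowerSeries.X_pow_dvd_iff] at h1 ⊢
  intro m hm
  have := h1 (Finsupp.single 1 l + m) (by simpa using hm)
  rw [MvPowerSeries.X_pow_eq, MvPowerSeries.coeff_add_monomial_mul] at this
  simpa using this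

lemma dvd_of_fin (D E w z : MvPowerSeries (Fin 2) ℂ) (hD : D ≠ 0)
    (hI : FiniteDimensional ℂ (MvPowerSeries (Fin 2) ℂ ⧸ Ideal.span {D, E}))
    (h : w * E = z * D) : ∃ u, w = u * D := by
  obtain ⟨k, hk⟩ := X_pow_mem_of_fin _ hI 0
  obtain ⟨l, hl⟩ := X_pow_mem_of_fin _ hI 1
  obtain ⟨a, b, hab⟩ := Ideal.mem_span_pair.mp hk
  obtain ⟨c, d, hcd⟩ := Ideal.mem_span_pair.mp hl
  have e1 : MvPowerSeries.X 0 ^ k * w = (a * w + b * z) * D := by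
    rw [← hab]; linear_combination b * h
  have e2 : MvPowerSeries.X 1 ^ l * w = (c * w + d * z) * D := by
    rw [← hcd]; linear_combination d * h
  have e3 : MvPowerSeries.X 1 ^ l * (a * w + b * z) = MvPowerSeries.X 0 ^ k * (c * w + d * z) := by
    apply mul_right_cancel₀ hD
    linear_combination MvPowerSeries.X 0 ^ k * e2 - MvPowerSeries.X 1 ^ l * e1
  obtain ⟨u, hu⟩ := X_pow_dvd_aux k l _ _ e3
  refine ⟨u, ?_⟩
  have hX : (MvPowerSeries.X 0 : MvPowerSeries (Fin 2) ℂ) ^ k ≠ 0 := by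
    apply pow_ne_zero
    intro h0
    have := congrArg (MvPowerSeries.coeff (Finsupp.single 0 1)) h0
    rw [MvPowerSeries.coeff_index_single_self_X] at this
    simp at this
  apply mul_left_cancel₀ hX
  rw [e1, hu]; ring

theorem stmt1 (f₁ f₂ : MvPowerSeries (Fin 2) ℂ)
    (Δ : MvPowerSeries (Fin 2) ℂ) (hΔ : Δ = det2 f₁ f₂)
    (J₁ I₂ J : Ideal (MvPowerSeries (Fin 2) ℂ))
    -- the Jacobian ideal of `f₁`
    (hJ₁ : J₁ = Ideal.span {pd 0 f₁, pd 1 f₁})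
    -- the ideal `⟨Δ, det(df₁, dΔ)⟩`
    (hI₂ : I₂ = Ideal.span {Δ, det2 f₁ Δ})
    -- `J(f,Δ)`: the ideal of the 2×2 minors of the Jacobian of `(f₁, f₂, Δ)`
    (hJ : J = Ideal.span {det2 f₁ f₂, det2 f₁ Δ, det2 f₂ Δ})
    -- both ideals have finite colength
    (hfin₂ : FiniteDimensional ℂ (MvPowerSeries (Fin 2) ℂ ⧸ I₂))
    (hfinJ : FiniteDimensional ℂ (MvPowerSeries (Fin 2) ℂ ⧸ J))
    -- `f₁` has an isolated singularity
    (hiso : FiniteDimensional ℂ (MvPowerSeries (Fin 2) ℂ ⧸ J₁)) :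
    -- multiplication by `det(df₂, dΔ)` descends to a map `O₂/Jf₁ → O₂/I₂` …
    (∀ a ∈ J₁, Ideal.Quotient.mk I₂ (det2 f₂ Δ * a) = 0) ∧
    -- … which is injective,
    (∀ a : MvPowerSeries (Fin 2) ℂ,
        Ideal.Quotient.mk I₂ (det2 f₂ Δ * a) = 0 → a ∈ J₁) ∧
    -- the sequence is exact at the middle term: the kernel of the projection
    -- `O₂/I₂ → O₂/J(f,Δ)` is the image of multiplication by `det(df₂,dΔ)`,
    (∀ b : MvPowerSeries (Fin 2) ℂ,
        Ideal.Quotient.mk J b = 0 ↔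
          ∃ a : MvPowerSeries (Fin 2) ℂ,
            Ideal.Quotient.mk I₂ b = Ideal.Quotient.mk I₂ (det2 f₂ Δ * a)) ∧
    -- and the projection `π : O₂/I₂ → O₂/J(f,Δ)` is surjective.
    (∀ c : MvPowerSeries (Fin 2) ℂ ⧸ J,
        ∃ b : MvPowerSeries (Fin 2) ℂ, Ideal.Quotient.mk J b = c) := by
  have hΔ0 : Δ ≠ 0 := by
    intro h0
    have hd : det2 f₁ Δ = 0 := by
      have hz : ∀ i, pd i (0 : MvPowerSeries (Fin 2) ℂ) = 0 := by
        intro i; funext m; exact mul_zero _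
      rw [h0, det2, hz, hz]; ring
    obtain ⟨k, hk⟩ := X_pow_mem_of_fin _ hfin₂ 0
    rw [hI₂, hd, h0] at hk
    simp only [Set.mem_singleton_iff, Set.insert_eq_of_mem, Ideal.mem_span_singleton,
      zero_dvd_iff] at hk
    have := congrArg (MvPowerSeries.coeff (Finsupp.single 0 k)) hk
    rw [MvPowerSeries.coeff_X_pow] at this
    simp at this
  subst hI₂ hJ₁ hJ
  have k0 : pd 0 f₁ * det2 f₂ Δ = pd 0 f₂ * det2 f₁ Δ - pd 0 Δ * Δ := by
    conv_rhs => rw [sub_eq_add_neg]; arg 2; arg 1; arg 2; rw [hΔ]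
    simp only [det2]; ring
  have k1 : pd 1 f₁ * det2 f₂ Δ = pd 1 f₂ * det2 f₁ Δ - pd 1 Δ * Δ := by
    conv_rhs => rw [sub_eq_add_neg]; arg 2; arg 1; arg 2; rw [hΔ]
    simp only [det2]; ring
  have kΔ : Δ = pd 0 f₁ * pd 1 f₂ - pd 1 f₁ * pd 0 f₂ := hΔ
  rw [← hΔ]
  generalize det2 f₁ Δ = E at *
  generalize det2 f₂ Δ = F at *
  refine ⟨?_, ?_, ?_, Ideal.Quotient.mk_surjective⟩
  · intro a ha
    obtain ⟨u, v, rfl⟩ := Ideal.mem_span_pair.mp ha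
    rw [Ideal.Quotient.eq_zero_iff_mem, Ideal.mem_span_pair]
    exact ⟨-(u * pd 0 Δ + v * pd 1 Δ), u * pd 0 f₂ + v * pd 1 f₂, by
      linear_combination -u * k0 - v * k1⟩
  · intro a ha
    rw [Ideal.Quotient.eq_zero_iff_mem, Ideal.mem_span_pair] at ha
    obtain ⟨α, β, h⟩ := ha
    obtain ⟨u, hu⟩ := dvd_of_fin Δ E (a * pd 0 f₂ - pd 0 f₁ * β)
      (pd 0 f₁ * α + a * pd 0 Δ) hΔ0 hfin₂ (by linear_combination -a * k0 - pd 0 f₁ * h)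
    obtain ⟨v, hv⟩ := dvd_of_fin Δ E (a * pd 1 f₂ - pd 1 f₁ * β)
      (pd 1 f₁ * α + a * pd 1 Δ) hΔ0 hfin₂ (by linear_combination -a * k1 - pd 1 f₁ * h)
    rw [Ideal.mem_span_pair]
    refine ⟨v, -u, ?_⟩
    apply mul_right_cancel₀ hΔ0
    linear_combination pd 1 f₁ * hu - pd 0 f₁ * hv - a * kΔ
  · intro b
    rw [Ideal.Quotient.eq_zero_iff_mem]
    simp only [Ideal.Quotient.eq, Ideal.mem_span_pair]
    constructor
    · intro hb
      rw [Ideal.mem_span_insert] at hb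
      obtain ⟨x, z, hz, rfl⟩ := hb
      obtain ⟨y, w, rfl⟩ := Ideal.mem_span_pair.mp hz
      exact ⟨w, x, y, by ring⟩
    · rintro ⟨a, x, y, h⟩
      rw [Ideal.mem_span_insert]
      exact ⟨x, y * E + a * F, Ideal.mem_span_pair.mpr ⟨y, a, rfl⟩, by linear_combination -h⟩
end

section
/- Let X ⊂ ℂ⁴ be the hypersurface defined by φ(x,y,z,w) = x² − z³ and f₂(x,y,z,w) = y² + w. Consider the ideal I⁻ in the polynomial ring ℂ[x,y,z,w,p₁,p₂,p₃,p₄] generated by p₂ − 2yp₄, φ·p₄, f₂·p₄, 3xp₁ + 2zp₃, 3z²p₁ + 2xp₃, f₂·p₁, f₂·p₃, together with φ and f₂. Then the quotient ring ℂ[x,y,z,w,p₁,p₂,p₃,p₄]/I⁻ has Krull dimension 4. -/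
/-!  STATEMENT 4.  In `ℂ[x,y,z,w,p₁,p₂,p₃,p₄]` (variables `X 0, …, X 7`
standing for `x, y, z, w, p₁, p₂, p₃, p₄`), the ideal `I⁻` defining the
relative logarithmic characteristic variety `LC(X ∩ f₂⁻¹(0))⁻` for
`φ = x² − z³`, `f₂ = y² + w`, has quotient ring of Krull dimension `4`. -/

open MvPolynomial

theorem aux_dim_le {A B : Type} [CommRing A] [CommRing B] [Algebra A B]
    [Algebra.IsIntegral A B] : ringKrullDim B ≤ ringKrullDim A := by
  refine Order.krullDim_le_of_strictMono (PrimeSpectrum.comap (algebraMap A B)) ?_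
  intro P Q h
  have h' : P.asIdeal < Q.asIdeal := h
  exact Ideal.IsIntegral.comap_lt_comap (R := A) h'

theorem aux_integral {A B : Type} [CommRing A] [CommRing B] [Algebra A B] (z : B) (c d : A)
    (h : z ^ 4 + algebraMap A B c * z ^ 3 + algebraMap A B d * z ^ 2 = 0) : IsIntegral A z := by
  refine ⟨Polynomial.X ^ 4 + Polynomial.C c * Polynomial.X ^ 3
    + Polynomial.C d * Polynomial.X ^ 2, ?_, ?_⟩
  · monicity!
  · simpa using h

theorem aux_top {A B : Type} [CommRing A] [CommRing B] [Algebra A B] [Algebra ℂ A]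
    (f : MvPolynomial (Fin 8) ℂ →+* B) (hf : Function.Surjective f)
    (hC : ∀ r : ℂ, f (C r) = algebraMap A B (algebraMap ℂ A r))
    (hX : ∀ i, IsIntegral A (f (X i))) : Algebra.IsIntegral A B := by
  refine ⟨fun b => ?_⟩
  obtain ⟨p, rfl⟩ := hf b
  induction p using MvPolynomial.induction_on with
  | C r => rw [hC]; exact isIntegral_algebraMap
  | add p q hp hq => rw [map_add]; exact hp.add hq
  | mul_X p i hp => rw [map_mul]; exact hp.mul (hX i)

theorem aux_dim4 : ringKrullDim (MvPolynomial (Fin 4) ℂ) = 4 := by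
  rw [MvPolynomial.ringKrullDim_of_isNoetherianRing, ringKrullDim_eq_zero_of_field]
  simp

theorem stmt4 (Iminus : Ideal (MvPolynomial (Fin 8) ℂ))
    (hI : Iminus = Ideal.span
      { X 5 - 2 * X 1 * X 7,                      -- p₂ − 2yp₄
        (X 0 ^ 2 - X 2 ^ 3) * X 7,                -- φ·p₄
        (X 1 ^ 2 + X 3) * X 7,                    -- f₂·p₄
        3 * X 0 * X 4 + 2 * X 2 * X 6,            -- 3xp₁ + 2zp₃
        3 * X 2 ^ 2 * X 4 + 2 * X 0 * X 6,        -- 3z²p₁ + 2xp₃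
        (X 1 ^ 2 + X 3) * X 4,                    -- f₂·p₁
        (X 1 ^ 2 + X 3) * X 6,                    -- f₂·p₃
        X 0 ^ 2 - X 2 ^ 3,                        -- φ
        X 1 ^ 2 + X 3 }) :                        -- f₂
    ringKrullDim (MvPolynomial (Fin 8) ℂ ⧸ Iminus) = 4 := by
  apply le_antisymm
  · let q : MvPolynomial (Fin 8) ℂ →ₐ[ℂ] (MvPolynomial (Fin 8) ℂ ⧸ Iminus) :=
      Ideal.Quotient.mkₐ ℂ Iminus
    have hq : ∀ p ∈ Iminus, q p = 0 := fun p hp => Ideal.Quotient.eq_zero_iff_mem.mpr hp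
    have q2 : q 2 = 2 := map_ofNat q 2
    have q3 : q 3 = 3 := map_ofNat q 3
    let g : MvPolynomial (Fin 4) ℂ →ₐ[ℂ] (MvPolynomial (Fin 8) ℂ ⧸ Iminus) :=
      aeval ![q (X 1), q (X 7), q (X 4), q (X 6) + q (X 2)]
    let : Algebra (MvPolynomial (Fin 4) ℂ) (MvPolynomial (Fin 8) ℂ ⧸ Iminus) :=
      g.toRingHom.toAlgebra
    have hg : ∀ p, algebraMap (MvPolynomial (Fin 4) ℂ) (MvPolynomial (Fin 8) ℂ ⧸ Iminus) p = g p :=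
      fun p => rfl
    have g0 : g (X 0) = q (X 1) := by simp [g]
    have g1 : g (X 1) = q (X 7) := by simp [g]
    have g2 : g (X 2) = q (X 4) := by simp [g]
    have g3 : g (X 3) = q (X 6) + q (X 2) := by simp [g]
    have e1 : q (X 5) - 2 * q (X 1) * q (X 7) = 0 := by
      have := hq (X 5 - 2 * X 1 * X 7) (by rw [hI]; exact Ideal.subset_span (by simp))
      simpa only [map_sub, map_add, map_mul, map_pow, map_ofNat, q2, q3] using this
    have e2 : 3 * q (X 0) * q (X 4) + 2 * q (X 2) * q (X 6) = 0 := by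
      have := hq (3 * X 0 * X 4 + 2 * X 2 * X 6) (by rw [hI]; exact Ideal.subset_span (by simp))
      simpa only [map_sub, map_add, map_mul, map_pow, map_ofNat, q2, q3] using this
    have e3 : q (X 0) ^ 2 - q (X 2) ^ 3 = 0 := by
      have := hq (X 0 ^ 2 - X 2 ^ 3) (by rw [hI]; exact Ideal.subset_span (by simp))
      simpa only [map_sub, map_add, map_mul, map_pow, map_ofNat, q2, q3] using this
    have e4 : q (X 1) ^ 2 + q (X 3) = 0 := by
      have := hq (X 1 ^ 2 + X 3) (by rw [hI]; exact Ideal.subset_span (by simp))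
      simpa only [map_sub, map_add, map_mul, map_pow, map_ofNat, q2, q3] using this
    have hk : g (C (1 / 4)) * 4 = 1 := by
      have h4 : (4 : MvPolynomial (Fin 8) ℂ ⧸ Iminus) = g (C 4) := by
        rw [show (C 4 : MvPolynomial (Fin 4) ℂ) = 4 from map_ofNat C 4, map_ofNat]
      rw [h4, ← map_mul, ← C_mul]
      norm_num
    have i1 : IsIntegral (MvPolynomial (Fin 4) ℂ) (q (X 1)) := by
      rw [← g0, ← hg]; exact isIntegral_algebraMap
    have i7 : IsIntegral (MvPolynomial (Fin 4) ℂ) (q (X 7)) := by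
      rw [← g1, ← hg]; exact isIntegral_algebraMap
    have i4 : IsIntegral (MvPolynomial (Fin 4) ℂ) (q (X 4)) := by
      rw [← g2, ← hg]; exact isIntegral_algebraMap
    have i2 : IsIntegral (MvPolynomial (Fin 4) ℂ) (q (X 2)) := by
      refine aux_integral _ (-2 * X 3 - C (1 / 4) * 9 * X 2 ^ 2) (X 3 ^ 2) ?_
      simp only [hg, map_sub, map_mul, map_neg, map_pow, map_ofNat, g2, g3]
      generalize g (C (1 / 4)) = k at hk
      generalize q (X 0) = x at *
      generalize q (X 2) = z at *
      generalize q (X 4) = a at *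
      generalize q (X 6) = b at *
      linear_combination (-z ^ 2 * b ^ 2) * hk + k * (2 * z * b - 3 * x * a) * e2
        + 9 * k * a ^ 2 * e3
    have i6 : IsIntegral (MvPolynomial (Fin 4) ℂ) (q (X 6)) := by
      have : q (X 6) = g (X 3) - q (X 2) := by rw [g3]; ring
      rw [this, ← hg]; exact isIntegral_algebraMap.sub i2
    have i0 : IsIntegral (MvPolynomial (Fin 4) ℂ) (q (X 0)) := by
      refine IsIntegral.of_pow (n := 2) (by norm_num) ?_
      rw [sub_eq_zero.mp e3]; exact i2.pow 3
    have i3 : IsIntegral (MvPolynomial (Fin 4) ℂ) (q (X 3)) := by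
      rw [(neg_eq_of_add_eq_zero_right e4).symm]; exact (i1.pow 2).neg
    have i5 : IsIntegral (MvPolynomial (Fin 4) ℂ) (q (X 5)) := by
      rw [sub_eq_zero.mp e1, mul_assoc, two_mul]; exact (i1.mul i7).add (i1.mul i7)
    have : Algebra.IsIntegral (MvPolynomial (Fin 4) ℂ) (MvPolynomial (Fin 8) ℂ ⧸ Iminus) := by
      refine aux_top q.toRingHom (Ideal.Quotient.mkₐ_surjective ℂ Iminus) ?_ ?_
      · intro r
        rw [hg, AlgHom.commutes]
        exact q.commutes r
      · intro i
        fin_cases i <;> assumption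
    exact aux_dim_le.trans aux_dim4.le
  · let h : MvPolynomial (Fin 8) ℂ →ₐ[ℂ] MvPolynomial (Fin 4) ℂ :=
      aeval ![0, X 0, 0, - X 0 ^ 2, X 1, 2 * X 0 * X 3, X 2, X 3]
    have h2 : h 2 = 2 := map_ofNat h 2
    have hs : Function.Surjective h := by
      rw [← AlgHom.range_eq_top, eq_top_iff, ← MvPolynomial.adjoin_range_X, Algebra.adjoin_le_iff]
      rintro _ ⟨i, rfl⟩
      fin_cases i
      · exact ⟨X 1, by simp [h]⟩
      · exact ⟨X 4, by simp [h]⟩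
      · exact ⟨X 6, by simp [h]⟩
      · exact ⟨X 7, by simp [h]⟩
    have hle : ∀ p ∈ Iminus, h.toRingHom p = 0 := by
      intro p hp
      have : Iminus ≤ RingHom.ker h.toRingHom := by
        rw [hI, Ideal.span_le]
        intro p hp
        simp only [Set.mem_insert_iff, Set.mem_singleton_iff] at hp
        rcases hp with rfl | rfl | rfl | rfl | rfl | rfl | rfl | rfl | rfl <;>
          first
          | (simp [h, RingHom.mem_ker]; done)
          | (change h _ = 0
             simp only [map_sub, map_mul, h2]
             simp [h])
      exact this hp
    rw [← aux_dim4]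
    exact ringKrullDim_le_of_surjective (Ideal.Quotient.lift Iminus h.toRingHom hle)
      (Ideal.Quotient.lift_surjective_of_surjective Iminus hle hs)
end

section
/- Let I⁻ ⊂ ℂ[x,y,z,w,p₁,p₂,p₃,p₄] be the ideal generated by xp₂ + 2yp₃ + 3zp₄, 2xp₁ + yp₂ − wp₄, yp₂ + 2zp₃ + 3wp₄, 3yp₁ + 2zp₂ + wp₃, −3xwp₁ + (2z² − 3yw)p₂ + zwp₃ + 3w²p₄, together with xz − y², xw − yz and yw − z². Then the quotient ring ℂ[x,y,z,w,p₁,p₂,p₃,p₄]/I⁻ is Cohen–Macaulay of dimension 4. -/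
open MvPolynomial

theorem aux_dim {A R : Type} [CommRing A] [CommRing R] [Algebra A R]
    [Module.Finite A R] [FaithfulSMul A R] : ringKrullDim R = ringKrullDim A := by
  apply le_antisymm
  · refine Order.krullDim_le_of_strictMono (PrimeSpectrum.comap (algebraMap A R)) ?_
    intro p q h
    exact Ideal.IsIntegral.comap_lt_comap (R := A) (I := p.asIdeal) (J := q.asIdeal) h
  · refine iSup_le fun p => ?_
    have : ∃ Q : PrimeSpectrum R, PrimeSpectrum.comap (algebraMap A R) Q = p.head := by
      obtain ⟨Q, _, hQ, h⟩ := Ideal.exists_ideal_over_prime_of_isIntegral (S := R) p.head.asIdeal ⊥ 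
        (by
          intro a ha
          have : a = 0 := by simpa using ha
          simp [this])
      exact ⟨⟨Q, hQ⟩, PrimeSpectrum.ext h⟩
    obtain ⟨Q, hQ⟩ := this
    have : Q.asIdeal.LiesOver p.head.asIdeal := ⟨by rw [← hQ]; rfl⟩
    obtain ⟨L, hL, _⟩ := Ideal.exists_ltSeries_of_hasGoingUp p Q.asIdeal
    refine le_trans ?_ (le_iSup _ L)
    exact_mod_cast hL.ge

theorem aux_reg : RingTheory.Sequence.IsRegular (MvPolynomial (Fin 4) ℂ)
    ([X 0, X 1, X 2, X 3] : List (MvPolynomial (Fin 4) ℂ)) := by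
  have key : ∀ (s : Set (Fin 4)) (i : Fin 4) (J : Ideal (MvPolynomial (Fin 4) ℂ)), i ∉ s →
      J = Ideal.span (X '' s) → 
      IsSMulRegular (MvPolynomial (Fin 4) ℂ ⧸ (J • ⊤ : Submodule (MvPolynomial (Fin 4) ℂ) (MvPolynomial (Fin 4) ℂ))) (X i : MvPolynomial (Fin 4) ℂ) := by
    rintro s i J hi rfl
    rw [isSMulRegular_quotient_iff_mem_of_smul_mem]
    intro f hf
    simp only [smul_eq_mul, Ideal.mul_top] at hf ⊢
    rw [mem_ideal_span_X_image] at hf ⊢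
    intro m hm
    obtain ⟨j, hj, h⟩ := hf (Finsupp.single i 1 + m) (by
      rw [mem_support_iff, coeff_X_mul]; simpa using hm)
    refine ⟨j, hj, ?_⟩
    have : i ≠ j := by rintro rfl; exact hi hj
    simpa [Finsupp.single_apply, this] using h
  constructor
  · rw [RingTheory.Sequence.isWeaklyRegular_iff_Fin]
    intro i
    fin_cases i
    · exact key ∅ 0 _ (by simp) (by simp)
    · exact key {0} 1 _ (by simp) (by simp)
    · exact key {0, 1} 2 _ (by simp) (by simp [Set.image_insert_eq, Ideal.span_insert])
    · exact key {0, 1, 2} 3 _ (by simp) (by simp [Set.image_insert_eq, Ideal.span_insert])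
  · intro h
    have h1 : (1 : MvPolynomial (Fin 4) ℂ) ∈ Ideal.span (X '' (Set.univ : Set (Fin 4))) := by
      have : (1 : MvPolynomial (Fin 4) ℂ) ∈ (⊤ : Submodule (MvPolynomial (Fin 4) ℂ) (MvPolynomial (Fin 4) ℂ)) := trivial
      rw [h] at this
      simp only [smul_eq_mul, Ideal.mul_top] at this
      refine (Ideal.span_mono ?_) this
      intro x hx
      simp only [List.mem_cons, List.not_mem_nil, or_false, Set.mem_ofPred_eq] at hx
      rcases hx with rfl | rfl | rfl | rfl <;> exact ⟨_, trivial, rfl⟩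
    rw [mem_ideal_span_X_image] at h1
    obtain ⟨i, _, h⟩ := h1 0 (by simp)
    simp at h

section mats
variable {A : Type} [CommRing A] (a b c d : A)

def mX : (Fin 8 → A) →ₗ[A] (Fin 8 → A) where
  toFun v := ![0,
    v 0 - a * v 1 + b*c * v 6 + 2*b^2 * v 7,
    -2*b * v 1 - a * v 2 + 2*c^2 * v 6 + 5*b*c * v 7,
    -c * v 1 - 2*b * v 2 + c*d * v 6 + (2*b*d+2*c^2) * v 7,
    -c * v 2 + c*d * v 7,
    v 3 - a * v 5,
    v 4 - 2*b * v 5 - a * v 6,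
    -c * v 5 - 2*b * v 6 - a * v 7]
  map_add' u v := by ext i; fin_cases i <;> simp <;> ring
  map_smul' r v := by ext i; fin_cases i <;> simp <;> ring

def mY : (Fin 8 → A) →ₗ[A] (Fin 8 → A) where
  toFun v := ![0,
    c*b * v 5 + 2*b^2 * v 6 + a*b * v 7,
    v 0 - a * v 1 + 2*c^2 * v 5 + 5*b*c * v 6 + (2*b^2+2*a*c) * v 7,
    -2*b * v 1 + c*d * v 5 + (2*b*d+2*c^2) * v 6 + 5*b*c * v 7,
    -c * v 1 + c*d * v 6 + 2*c^2 * v 7,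
    v 2 - d * v 7,
    v 3 - a * v 5,
    v 4 - 2*b * v 5 - a * v 6]
  map_add' u v := by ext i; fin_cases i <;> simp <;> ring
  map_smul' r v := by ext i; fin_cases i <;> simp <;> ring

def mZ : (Fin 8 → A) →ₗ[A] (Fin 8 → A) where
  toFun v := ![0,
    -b * v 4 + 2*b^2 * v 5 + a*b * v 6,
    -2*c * v 4 + 5*b*c * v 5 + (2*b^2+2*a*c) * v 6 + a*b * v 7,
    v 0 - d * v 4 + (2*b*d+2*c^2) * v 5 + 5*b*c * v 6 + 2*b^2 * v 7,
    c*d * v 5 + 2*c^2 * v 6 + b*c * v 7,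
    v 1 - d * v 6 - 2*c * v 7,
    v 2 - d * v 7,
    v 3 - a * v 5]
  map_add' u v := by ext i; fin_cases i <;> simp <;> ring
  map_smul' r v := by ext i; fin_cases i <;> simp <;> ring

def mW : (Fin 8 → A) →ₗ[A] (Fin 8 → A) where
  toFun v := ![0,
    -b * v 3 + a*b * v 5,
    -2*c * v 3 - b * v 4 + (2*b^2+2*a*c) * v 5 + a*b * v 6,
    -d * v 3 - 2*c * v 4 + 5*b*c * v 5 + 2*b^2 * v 6,
    v 0 - d * v 4 + 2*c^2 * v 5 + b*c * v 6,
    -d * v 5 - 2*c * v 6 - b * v 7,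
    v 1 - d * v 6 - 2*c * v 7,
    v 2 - d * v 7]
  map_add' u v := by ext i; fin_cases i <;> simp <;> ring
  map_smul' r v := by ext i; fin_cases i <;> simp <;> ring

theorem mXY : mX a b c d * mY a b c d = mY a b c d * mX a b c d := by
  refine LinearMap.ext fun v => funext fun i => ?_
  fin_cases i <;> simp [mX, mY] <;> ring
theorem mXZ : mX a b c d * mZ a b c d = mZ a b c d * mX a b c d := by
  refine LinearMap.ext fun v => funext fun i => ?_
  fin_cases i <;> simp [mX, mZ] <;> ring
theorem mXW : mX a b c d * mW a b c d = mW a b c d * mX a b c d := by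
  refine LinearMap.ext fun v => funext fun i => ?_
  fin_cases i <;> simp [mX, mW] <;> ring
theorem mYZ : mY a b c d * mZ a b c d = mZ a b c d * mY a b c d := by
  refine LinearMap.ext fun v => funext fun i => ?_
  fin_cases i <;> simp [mY, mZ] <;> ring
theorem mYW : mY a b c d * mW a b c d = mW a b c d * mY a b c d := by
  refine LinearMap.ext fun v => funext fun i => ?_
  fin_cases i <;> simp [mY, mW] <;> ring
theorem mZW : mZ a b c d * mW a b c d = mW a b c d * mZ a b c d := by
  refine LinearMap.ext fun v => funext fun i => ?_
  fin_cases i <;> simp [mZ, mW] <;> ring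

-- the seven relations
theorem r1 : mX a b c d * mZ a b c d = mY a b c d * mY a b c d := by
  refine LinearMap.ext fun v => funext fun i => ?_
  fin_cases i <;> simp [mX, mY, mZ] <;> ring
theorem r2 : mX a b c d * mW a b c d = mY a b c d * mZ a b c d := by
  refine LinearMap.ext fun v => funext fun i => ?_
  fin_cases i <;> simp [mX, mY, mZ, mW] <;> ring
theorem r3 : mY a b c d * mW a b c d = mZ a b c d * mZ a b c d := by
  refine LinearMap.ext fun v => funext fun i => ?_
  fin_cases i <;> simp [mY, mZ, mW] <;> ring
theorem r4 : mZ a b c d * mW a b c d =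
    -(b • mX a b c d + (2 * c) • mY a b c d + d • mZ a b c d) := by
  refine LinearMap.ext fun v => funext fun i => ?_
  fin_cases i <;> simp [mX, mY, mZ, mW] <;> ring
theorem r5 : mW a b c d * mW a b c d =
    -(b • mY a b c d + (2 * c) • mZ a b c d + d • mW a b c d) := by
  refine LinearMap.ext fun v => funext fun i => ?_
  fin_cases i <;> simp [mY, mZ, mW] <;> ring
theorem r6 : mX a b c d * mX a b c d =
    -(a • mX a b c d + (2 * b) • mY a b c d + c • mZ a b c d) := by
  refine LinearMap.ext fun v => funext fun i => ?_
  fin_cases i <;> simp [mX, mY, mZ] <;> ring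
theorem r7 : mX a b c d * mY a b c d =
    -(a • mY a b c d + (2 * b) • mZ a b c d + c • mW a b c d) := by
  refine LinearMap.ext fun v => funext fun i => ?_
  fin_cases i <;> simp [mX, mY, mZ, mW] <;> ring
end mats

theorem exists_alg {A : Type} [CommRing A] (a b c d : A) :
    ∃ (S : Type) (_ : CommRing S) (_ : Algebra A S) (x y z w : S) (ev : S →ₗ[A] (Fin 8 → A)),
      (x * z = y * y ∧ x * w = y * z ∧ y * w = z * z ∧
      z * w = -(b • x + (2 * c) • y + d • z) ∧
      w * w = -(b • y + (2 * c) • z + d • w) ∧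
      x * x = -(a • x + (2 * b) • y + c • z) ∧
      x * y = -(a • y + (2 * b) • z + c • w)) ∧
      ∀ i, ev (![1, x, y, z, w, y * y, y * z, z * z] i) = Pi.single i 1 := by
  let s : Set (Module.End A (Fin 8 → A)) := {mX a b c d, mY a b c d, mZ a b c d, mW a b c d}
  have hs : ∀ u ∈ s, ∀ v ∈ s, u * v = v * u := by
    intro u hu v hv
    rcases hu with rfl | rfl | rfl | rfl <;> rcases hv with rfl | rfl | rfl | rfl <;>
    first
    | rfl
    | exact mXY a b c d
    | exact mXZ a b c d
    | exact mXW a b c d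
    | exact mYZ a b c d
    | exact mYW a b c d
    | exact mZW a b c d
    | exact (mXY a b c d).symm
    | exact (mXZ a b c d).symm
    | exact (mXW a b c d).symm
    | exact (mYZ a b c d).symm
    | exact (mYW a b c d).symm
    | exact (mZW a b c d).symm
  have hc := Algebra.isMulCommutative_adjoin A hs
  let cr : CommRing (Algebra.adjoin A s) :=
    { (inferInstance : Ring (Algebra.adjoin A s)) with
      mul_comm := fun u v => hc.is_comm.comm u v }
  let al : Algebra A (Algebra.adjoin A s) := inferInstance
  let ev : Algebra.adjoin A s →ₗ[A] (Fin 8 → A) :=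
    (LinearMap.applyₗ (R := A) (Pi.single 0 1 : Fin 8 → A)) ∘ₗ (Algebra.adjoin A s).val.toLinearMap
  refine ⟨Algebra.adjoin A s, cr, al,
    ⟨mX a b c d, Algebra.subset_adjoin (by simp [s])⟩,
    ⟨mY a b c d, Algebra.subset_adjoin (by simp [s])⟩,
    ⟨mZ a b c d, Algebra.subset_adjoin (by simp [s])⟩,
    ⟨mW a b c d, Algebra.subset_adjoin (by simp [s])⟩, ev, ⟨?_, ?_, ?_, ?_, ?_, ?_, ?_⟩, ?_⟩
  · exact Subtype.ext (r1 a b c d)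
  · exact Subtype.ext (r2 a b c d)
  · exact Subtype.ext (r3 a b c d)
  · exact Subtype.ext (r4 a b c d)
  · exact Subtype.ext (r5 a b c d)
  · exact Subtype.ext (r6 a b c d)
  · exact Subtype.ext (r7 a b c d)
  · intro i
    fin_cases i
    · rfl
    · change mX a b c d (Pi.single 0 1) = _
      funext j; fin_cases j <;> simp [mX]
    · change mY a b c d (Pi.single 0 1) = _
      funext j; fin_cases j <;> simp [mY]
    · change mZ a b c d (Pi.single 0 1) = _
      funext j; fin_cases j <;> simp [mZ]
    · change mW a b c d (Pi.single 0 1) = _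
      funext j; fin_cases j <;> simp [mW]
    · change mY a b c d (mY a b c d (Pi.single 0 1)) = _
      funext j; fin_cases j <;> simp [mY]
    · change mY a b c d (mZ a b c d (Pi.single 0 1)) = _
      funext j; fin_cases j <;> simp [mY, mZ]
    · change mZ a b c d (mZ a b c d (Pi.single 0 1)) = _
      funext j; fin_cases j <;> simp [mZ]

theorem aux_span {A R : Type} [CommRing A] [CommRing R] [Algebra A R] (a b c d : A)
    (x y z w : R)
    (h1 : x * z = y * y) (h2 : x * w = y * z) (h3 : y * w = z * z)
    (h4 : z * w = -(algebraMap A R b * x + 2 * algebraMap A R c * y + algebraMap A R d * z))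
    (h5 : w * w = -(algebraMap A R b * y + 2 * algebraMap A R c * z + algebraMap A R d * w))
    (h6 : x * x = -(algebraMap A R a * x + 2 * algebraMap A R b * y + algebraMap A R c * z))
    (h7 : x * y = -(algebraMap A R a * y + 2 * algebraMap A R b * z + algebraMap A R c * w))
    (N : Submodule A R)
    (hN : N = Submodule.span A (Set.range ![1, x, y, z, w, y * y, y * z, z * z])) :
    ∀ u ∈ ({x, y, z, w} : Set R), ∀ n ∈ N, u * n ∈ N := by
  have hb : ∀ i, ![1, x, y, z, w, y * y, y * z, z * z] i ∈ N := fun i => by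
    rw [hN]; exact Submodule.subset_span ⟨i, rfl⟩
  have m0 : (1 : R) ∈ N := hb 0
  have m1 : x ∈ N := hb 1
  have m2 : y ∈ N := hb 2
  have m3 : z ∈ N := hb 3
  have m4 : w ∈ N := hb 4
  have m5 : y * y ∈ N := hb 5
  have m6 : y * z ∈ N := hb 6
  have m7 : z * z ∈ N := hb 7
  have sm : ∀ (r : A) (n : R), n ∈ N → algebraMap A R r * n ∈ N := fun r n hn => by
    rw [← Algebra.smul_def]; exact N.smul_mem r hn
  have sm2 : ∀ (r : A) (n : R), n ∈ N → 2 * algebraMap A R r * n ∈ N := fun r n hn => by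
    have := sm (2 * r) n hn
    simpa only [map_mul, map_ofNat] using this
  have lin : ∀ (p q r : A) (u v t : R), u ∈ N → v ∈ N → t ∈ N →
      -(algebraMap A R p * u + 2 * algebraMap A R q * v + algebraMap A R r * t) ∈ N :=
    fun p q r u v t hu hv ht =>
      N.neg_mem (N.add_mem (N.add_mem (sm _ _ hu) (sm2 _ _ hv)) (sm _ _ ht))
  have q1 : x * x ∈ N := h6 ▸ lin _ _ _ _ _ _ m1 m2 m3
  have q2 : x * y ∈ N := h7 ▸ lin _ _ _ _ _ _ m2 m3 m4
  have q3 : x * z ∈ N := h1 ▸ m5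
  have q4 : x * w ∈ N := h2 ▸ m6
  have q5 : y * w ∈ N := h3 ▸ m7
  have q6 : z * w ∈ N := h4 ▸ lin _ _ _ _ _ _ m1 m2 m3
  have q7 : w * w ∈ N := h5 ▸ lin _ _ _ _ _ _ m2 m3 m4
  have t1 : x * (y * y) ∈ N := by
    have e : x * (y * y) = -(algebraMap A R a * (y * y) + 2 * algebraMap A R b * (y * z)
      + algebraMap A R c * (y * w)) := by linear_combination y * h7
    rw [e]; exact lin _ _ _ _ _ _ m5 m6 q5
  have t2 : x * (y * z) ∈ N := by
    have e : x * (y * z) = -(algebraMap A R a * (y * z) + 2 * algebraMap A R b * (z * z)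
      + algebraMap A R c * (z * w)) := by linear_combination z * h7
    rw [e]; exact lin _ _ _ _ _ _ m6 m7 q6
  have t3 : x * (z * z) ∈ N := by
    have e : x * (z * z) = -(algebraMap A R a * (y * w) + 2 * algebraMap A R b * (z * w)
      + algebraMap A R c * (w * w)) := by linear_combination w * h7 - x * h3
    rw [e]; exact lin _ _ _ _ _ _ q5 q6 q7
  have t4 : y * (z * z) ∈ N := by
    have e : y * (z * z) = -(algebraMap A R b * (x * x) + 2 * algebraMap A R c * (x * y)
      + algebraMap A R d * (x * z)) := by linear_combination x * h4 - z * h2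
    rw [e]; exact lin _ _ _ _ _ _ q1 q2 q3
  have t5 : z * (z * z) ∈ N := by
    have e : z * (z * z) = -(algebraMap A R b * (x * y) + 2 * algebraMap A R c * (y * y)
      + algebraMap A R d * (y * z)) := by linear_combination y * h4 - z * h3
    rw [e]; exact lin _ _ _ _ _ _ q2 m5 m6
  have t6 : w * (z * z) ∈ N := by
    have e : w * (z * z) = -(algebraMap A R b * (x * z) + 2 * algebraMap A R c * (y * z)
      + algebraMap A R d * (z * z)) := by linear_combination z * h4
    rw [e]; exact lin _ _ _ _ _ _ q3 m6 m7
  have e1 : y * (y * y) = x * (y * z) := by linear_combination -y * h1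
  have e2 : y * (y * z) = x * (z * z) := by linear_combination -z * h1
  have e3 : w * (y * y) = y * (z * z) := by linear_combination y * h3
  have e4 : w * (y * z) = z * (z * z) := by linear_combination z * h3
  have cl : ∀ u : R, (∀ i, u * ![1, x, y, z, w, y * y, y * z, z * z] i ∈ N) →
      ∀ n ∈ N, u * n ∈ N := by
    intro u hu n hn
    rw [hN] at hn
    induction hn using Submodule.span_induction with
    | mem v hv => obtain ⟨i, rfl⟩ := hv; exact hu i
    | zero => simp
    | add p q _ _ hp hq => rw [mul_add]; exact N.add_mem hp hq
    | smul r p _ hp => rw [mul_smul_comm]; exact N.smul_mem r hp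
  intro u hu
  apply cl
  rcases hu with rfl | rfl | rfl | rfl <;> intro i <;> fin_cases i
  · simpa using m1
  · exact q1
  · exact q2
  · exact q3
  · exact q4
  · exact t1
  · exact t2
  · exact t3
  · simpa using m2
  · exact mul_comm x u ▸ q2
  · exact m5
  · exact m6
  · exact q5
  · exact e1 ▸ t2
  · exact e2 ▸ t3
  · exact t4
  · simpa using m3
  · exact mul_comm x u ▸ q3
  · exact mul_comm y u ▸ m6
  · exact m7
  · exact q6
  · change u * (y * y) ∈ N
    rw [show u * (y * y) = y * (y * u) by ring, e2]; exact t3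
  · change u * (y * u) ∈ N
    rw [show u * (y * u) = y * (u * u) by ring]; exact t4
  · exact t5
  · simpa using m4
  · exact mul_comm x u ▸ q4
  · exact mul_comm y u ▸ q5
  · exact mul_comm z u ▸ q6
  · exact q7
  · exact e3 ▸ t4
  · exact e4 ▸ t5
  · exact t6

set_option synthInstance.maxHeartbeats 400000 in
set_option maxHeartbeats 4000000 in
theorem stmt5 (Iminus : Ideal (MvPolynomial (Fin 8) ℂ))
    (hI : Iminus = Ideal.span
      { X 0 * X 5 + 2 * X 1 * X 6 + 3 * X 2 * X 7,          -- xp₂ + 2yp₃ + 3zp₄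
        2 * X 0 * X 4 + X 1 * X 5 - X 3 * X 7,              -- 2xp₁ + yp₂ − wp₄
        X 1 * X 5 + 2 * X 2 * X 6 + 3 * X 3 * X 7,          -- yp₂ + 2zp₃ + 3wp₄
        3 * X 1 * X 4 + 2 * X 2 * X 5 + X 3 * X 6,          -- 3yp₁ + 2zp₂ + wp₃
        -3 * X 0 * X 3 * X 4 + (2 * X 2 ^ 2 - 3 * X 1 * X 3) * X 5
          + X 2 * X 3 * X 6 + 3 * X 3 ^ 2 * X 7,    -- −3xwp₁+(2z²−3yw)p₂+zwp₃+3w²p₄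
        X 0 * X 2 - X 1 ^ 2,                                -- xz − y²
        X 0 * X 3 - X 1 * X 2,                              -- xw − yz
        X 1 * X 3 - X 2 ^ 2 }) :                            -- yw − z²
    -- Krull dimension 4 …
    ringKrullDim (MvPolynomial (Fin 8) ℂ ⧸ Iminus) = 4 ∧
    -- … and Cohen–Macaulay: a regular sequence of length 4 in the maximal ideal
    ∃ rs : List (MvPolynomial (Fin 8) ℂ ⧸ Iminus),
      rs.length = 4 ∧
      (∀ r ∈ rs, r ∈ Ideal.map (Ideal.Quotient.mk Iminus)
          (Ideal.span (Set.range (X : Fin 8 → MvPolynomial (Fin 8) ℂ)))) ∧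
      RingTheory.Sequence.IsRegular (MvPolynomial (Fin 8) ℂ ⧸ Iminus) rs := by
  let π := Ideal.Quotient.mk Iminus
  let av : Fin 4 → MvPolynomial (Fin 8) ℂ :=
    ![X 4 - X 0, C (1/3) * X 5, C (1/3) * X 6, X 7 - X 3]
  let ι : MvPolynomial (Fin 4) ℂ →+* (MvPolynomial (Fin 8) ℂ ⧸ Iminus) :=
    eval₂Hom (π.comp C) (fun i => π (av i))
  let _ : Algebra (MvPolynomial (Fin 4) ℂ) (MvPolynomial (Fin 8) ℂ ⧸ Iminus) := ι.toAlgebra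
  have hι : ∀ p, algebraMap (MvPolynomial (Fin 4) ℂ) (MvPolynomial (Fin 8) ℂ ⧸ Iminus) p = ι p :=
    fun p => rfl
  have hιX : ∀ i, ι (X i) = π (av i) := fun i => by simp [ι]
  have hιC : ∀ r, ι (C r) = π (C r) := fun i => by simp [ι]
  have t3 : (3 : MvPolynomial (Fin 8) ℂ ⧸ Iminus) * π (C (1/3)) = 1 := by
    have : (3 : MvPolynomial (Fin 8) ℂ) * C (1/3) = 1 := by
      rw [show (3 : MvPolynomial (Fin 8) ℂ) = C 3 from (map_ofNat C 3).symm, ← C_mul]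
      norm_num
    have := congrArg π this
    simpa only [map_mul, map_ofNat, map_one] using this
  -- relations in the quotient
  have mem : ∀ g ∈ ({ X 0 * X 5 + 2 * X 1 * X 6 + 3 * X 2 * X 7,
        2 * X 0 * X 4 + X 1 * X 5 - X 3 * X 7,
        X 1 * X 5 + 2 * X 2 * X 6 + 3 * X 3 * X 7,
        3 * X 1 * X 4 + 2 * X 2 * X 5 + X 3 * X 6,
        -3 * X 0 * X 3 * X 4 + (2 * X 2 ^ 2 - 3 * X 1 * X 3) * X 5
          + X 2 * X 3 * X 6 + 3 * X 3 ^ 2 * X 7,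
        X 0 * X 2 - X 1 ^ 2,
        X 0 * X 3 - X 1 * X 2,
        X 1 * X 3 - X 2 ^ 2 } : Set (MvPolynomial (Fin 8) ℂ)), π g = 0 := by
    intro g hg
    rw [Ideal.Quotient.eq_zero_iff_mem, hI]
    exact Ideal.subset_span hg
  have g1 := mem (X 0 * X 5 + 2 * X 1 * X 6 + 3 * X 2 * X 7) (by simp)
  have g2 := mem (2 * X 0 * X 4 + X 1 * X 5 - X 3 * X 7) (by simp)
  have g3 := mem (X 1 * X 5 + 2 * X 2 * X 6 + 3 * X 3 * X 7) (by simp)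
  have g4 := mem (3 * X 1 * X 4 + 2 * X 2 * X 5 + X 3 * X 6) (by simp)
  have g6 := mem (X 0 * X 2 - X 1 ^ 2) (by simp)
  have g7 := mem (X 0 * X 3 - X 1 * X 2) (by simp)
  have g8 := mem (X 1 * X 3 - X 2 ^ 2) (by simp)
  simp only [map_add, map_sub, map_mul, map_pow, map_ofNat] at g1 g2 g3 g4 g6 g7 g8
  have A0 : ι (X 0) = π (X 4) - π (X 0) := by rw [hιX]; simp [av]
  have A1 : ι (X 1) = π (C (1/3)) * π (X 5) := by rw [hιX]; simp [av]
  have A2 : ι (X 2) = π (C (1/3)) * π (X 6) := by rw [hιX]; simp [av]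
  have A3 : ι (X 3) = π (X 7) - π (X 3) := by rw [hιX]; simp [av]
  have P4 : π (X 4) = ι (X 0) + π (X 0) := by rw [A0]; ring
  have P5 : π (X 5) = 3 * ι (X 1) := by rw [A1]; linear_combination (-π (X 5)) * t3
  have P6 : π (X 6) = 3 * ι (X 2) := by rw [A2]; linear_combination (-π (X 6)) * t3
  have P7 : π (X 7) = ι (X 3) + π (X 3) := by rw [A3]; ring
  rw [P5, P6, P7] at g1
  rw [P4, P5, P7] at g2
  rw [P5, P6, P7] at g3
  rw [P4, P5, P6] at g4
  generalize hτ : π (C (1/3)) = τ at t3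
  have c3 : ∀ u : MvPolynomial (Fin 8) ℂ ⧸ Iminus, 3 * u = 0 → u = 0 := fun u hu => by
    linear_combination τ * hu - u * t3
  have c2 : ∀ u : MvPolynomial (Fin 8) ℂ ⧸ Iminus, 2 * u = 0 → u = 0 := fun u hu => by
    have h2 : (2 : MvPolynomial (Fin 8) ℂ ⧸ Iminus) * π (C (1/2)) = 1 := by
      have : (2 : MvPolynomial (Fin 8) ℂ) * C (1/2) = 1 := by
        rw [show (2 : MvPolynomial (Fin 8) ℂ) = C 2 from (map_ofNat C 2).symm, ← C_mul]
        norm_num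
      have := congrArg π this
      simpa only [map_mul, map_ofNat, map_one] using this
    linear_combination π (C (1/2)) * hu - u * h2
  let bs : Fin 8 → MvPolynomial (Fin 8) ℂ ⧸ Iminus :=
    ![1, π (X 0), π (X 1), π (X 2), π (X 3), π (X 1) * π (X 1), π (X 1) * π (X 2),
      π (X 2) * π (X 2)]
  have h4 : π (X 2) * π (X 3) = -(ι (X 1) * π (X 0) + 2 * ι (X 2) * π (X 1)
      + ι (X 3) * π (X 2)) :=
    eq_of_sub_eq_zero (c3 _ (by linear_combination g1))
  have h5 : π (X 3) * π (X 3) = -(ι (X 1) * π (X 1) + 2 * ι (X 2) * π (X 2)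
      + ι (X 3) * π (X 3)) :=
    eq_of_sub_eq_zero (c3 _ (by linear_combination g3))
  have h7 : π (X 0) * π (X 1) = -(ι (X 0) * π (X 1) + 2 * ι (X 1) * π (X 2)
      + ι (X 2) * π (X 3)) :=
    eq_of_sub_eq_zero (c3 _ (by linear_combination g4))
  have h6 : π (X 0) * π (X 0) = -(ι (X 0) * π (X 0) + 2 * ι (X 1) * π (X 1)
      + ι (X 2) * π (X 2)) :=
    eq_of_sub_eq_zero (c2 _ (by linear_combination g2 + h5))
  have hspan := aux_span (A := MvPolynomial (Fin 4) ℂ) (X 0) (X 1) (X 2) (X 3)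
    (π (X 0)) (π (X 1)) (π (X 2)) (π (X 3))
    (by linear_combination g6) (by linear_combination g7) (by linear_combination g8)
    h4 h5 h6 h7 (Submodule.span _ (Set.range bs)) rfl
  have htop : ⊤ ≤ Submodule.span (MvPolynomial (Fin 4) ℂ) (Set.range bs) := by
    set N := Submodule.span (MvPolynomial (Fin 4) ℂ) (Set.range bs) with hN
    have one : (1 : MvPolynomial (Fin 8) ℂ ⧸ Iminus) ∈ N := Submodule.subset_span ⟨0, rfl⟩
    have sm : ∀ (r : MvPolynomial (Fin 4) ℂ) (n : MvPolynomial (Fin 8) ℂ ⧸ Iminus),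
        n ∈ N → ι r * n ∈ N := fun r n hn => by
      rw [← hι, ← Algebra.smul_def]; exact N.smul_mem r hn
    rintro r -
    obtain ⟨p, rfl⟩ := Ideal.Quotient.mk_surjective r
    change π p ∈ N
    induction p using MvPolynomial.induction_on with
    | C r =>
      have := sm (C r) 1 one
      rwa [mul_one, hιC] at this
    | add p q hp hq => rw [map_add]; exact N.add_mem hp hq
    | mul_X p i hp =>
      rw [map_mul, mul_comm]
      have k0 := hspan (π (X 0)) (by simp) _ hp
      have k3 := hspan (π (X 3)) (by simp) _ hp
      fin_cases i
      · exact k0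
      · exact hspan _ (by simp) _ hp
      · exact hspan _ (by simp) _ hp
      · exact k3
      · change π (X 4) * π p ∈ N
        rw [P4, add_mul]; exact N.add_mem (sm _ _ hp) k0
      · change π (X 5) * π p ∈ N
        rw [P5, show (3 : MvPolynomial (Fin 8) ℂ ⧸ Iminus) = ι 3 from (map_ofNat ι 3).symm,
          mul_assoc]
        exact sm _ _ (sm _ _ hp)
      · change π (X 6) * π p ∈ N
        rw [P6, show (3 : MvPolynomial (Fin 8) ℂ ⧸ Iminus) = ι 3 from (map_ofNat ι 3).symm,
          mul_assoc]
        exact sm _ _ (sm _ _ hp)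
      · change π (X 7) * π p ∈ N
        rw [P7, add_mul]; exact N.add_mem (sm _ _ hp) k3
  have hli : LinearIndependent (MvPolynomial (Fin 4) ℂ) bs := by
    obtain ⟨S, _, _, x, y, z, w, ev, ⟨s1, s2, s3, s4, s5, s6, s7⟩, hev⟩ :=
      exists_alg (X 0 : MvPolynomial (Fin 4) ℂ) (X 1) (X 2) (X 3)
    let α := algebraMap (MvPolynomial (Fin 4) ℂ) S
    have hα : ∀ (p : MvPolynomial (Fin 4) ℂ) (u : S), p • u = α p * u :=
      fun p u => Algebra.smul_def p u
    simp only [hα, map_mul, map_ofNat] at s4 s5 s6 s7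
    let φ : MvPolynomial (Fin 8) ℂ →+* S := eval₂Hom (α.comp C)
      ![x, y, z, w, x + α (X 0), 3 * α (X 1), 3 * α (X 2), w + α (X 3)]
    have f0 : φ (X 0) = x := by simp [φ]
    have f1 : φ (X 1) = y := by simp [φ]
    have f2 : φ (X 2) = z := by simp [φ]
    have f3 : φ (X 3) = w := by simp [φ]
    have f4 : φ (X 4) = x + α (X 0) := by simp [φ]
    have f5 : φ (X 5) = 3 * α (X 1) := by simp [φ]
    have f6 : φ (X 6) = 3 * α (X 2) := by simp [φ]
    have f7 : φ (X 7) = w + α (X 3) := by simp [φ]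
    have fC : ∀ r, φ (C r) = α (C r) := fun r => by simp [φ]
    have hker : ∀ p ∈ Iminus, φ p = 0 := by
      have : Iminus ≤ RingHom.ker φ := by
        rw [hI, Ideal.span_le]
        intro g hg
        change φ g = 0
        rcases hg with rfl | rfl | rfl | rfl | rfl | rfl | rfl | rfl <;>
          simp only [map_add, map_sub, map_mul, map_pow, map_ofNat, map_neg,
            f0, f1, f2, f3, f4, f5, f6, f7]
        · linear_combination 3 * s4
        · linear_combination 2 * s6 - s5
        · linear_combination 3 * s5
        · linear_combination 3 * s7
        · linear_combination (-3 * w) * s6 + 3 * w * s5 - 6 * α (X 1) * s3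
        · linear_combination s1
        · linear_combination s2
        · linear_combination s3
      exact this
    let ψ : (MvPolynomial (Fin 8) ℂ ⧸ Iminus) →+* S := Ideal.Quotient.lift Iminus φ hker
    have hψ : ∀ p, ψ (π p) = φ p := fun p => Ideal.Quotient.lift_mk _ _ _
    have t3' : (3 : S) * α (C (1/3)) = 1 := by
      have : (3 : MvPolynomial (Fin 4) ℂ) * C (1/3) = 1 := by
        rw [show (3 : MvPolynomial (Fin 4) ℂ) = C 3 from (map_ofNat C 3).symm, ← C_mul]
        norm_num
      have := congrArg α this
      simpa only [map_mul, map_ofNat, map_one] using this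
    have hψι : ψ.comp ι = α := by
      apply MvPolynomial.ringHom_ext
      · intro r
        rw [RingHom.comp_apply, hιC, hψ, fC]
      · intro i
        rw [RingHom.comp_apply, hιX, hψ]
        fin_cases i
        · simp [av, f4, f0]
        · change φ (C (1/3) * X 5) = α (X 1)
          rw [map_mul, fC, f5]; linear_combination α (X 1) * t3'
        · change φ (C (1/3) * X 6) = α (X 2)
          rw [map_mul, fC, f6]; linear_combination α (X 2) * t3'
        · simp [av, f7, f3]
    let ψl : (MvPolynomial (Fin 8) ℂ ⧸ Iminus) →ₗ[MvPolynomial (Fin 4) ℂ] S :=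
      { toFun := ψ
        map_add' := map_add ψ
        map_smul' := fun r u => by
          rw [Algebra.smul_def, map_mul, hι, RingHom.id_apply, hα, ← hψι]; rfl }
    have hcomp : (ev ∘ₗ ψl) ∘ bs = fun i => Pi.single i 1 := by
      funext i
      rw [← hev i]
      change ev (ψ (bs i)) = _
      congr 1
      fin_cases i <;> simp [bs, hψ, f0, f1, f2, f3]
    refine LinearIndependent.of_comp (ev ∘ₗ ψl) ?_
    rw [hcomp]
    have := (Pi.basisFun (MvPolynomial (Fin 4) ℂ) (Fin 8)).linearIndependent
    convert this using 1
    funext i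
    simp
  let B := Module.Basis.mk hli htop
  have : Module.Free (MvPolynomial (Fin 4) ℂ) (MvPolynomial (Fin 8) ℂ ⧸ Iminus) :=
    Module.Free.of_basis B
  have : Module.Finite (MvPolynomial (Fin 4) ℂ) (MvPolynomial (Fin 8) ℂ ⧸ Iminus) :=
    Module.Finite.of_basis B
  have : Nontrivial (MvPolynomial (Fin 8) ℂ ⧸ Iminus) := ⟨B 0, B 1, B.injective.ne (by decide)⟩
  have : FaithfulSMul (MvPolynomial (Fin 4) ℂ) (MvPolynomial (Fin 8) ℂ ⧸ Iminus) := inferInstance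
  refine ⟨?_, [X 0, X 1, X 2, X 3].map
    (algebraMap (MvPolynomial (Fin 4) ℂ) (MvPolynomial (Fin 8) ℂ ⧸ Iminus)), rfl, ?_, ?_⟩
  · rw [aux_dim (A := MvPolynomial (Fin 4) ℂ), MvPolynomial.ringKrullDim_of_isNoetherianRing,
      ringKrullDim_eq_zero_of_field]
    simp
  · have hX : ∀ i, (X i : MvPolynomial (Fin 8) ℂ) ∈
        Ideal.span (Set.range (X : Fin 8 → MvPolynomial (Fin 8) ℂ)) :=
      fun i => Ideal.subset_span ⟨i, rfl⟩
    have hav : ∀ i, ι (X i) ∈ Ideal.map (Ideal.Quotient.mk Iminus)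
          (Ideal.span (Set.range (X : Fin 8 → MvPolynomial (Fin 8) ℂ))) := by
      intro i
      rw [hιX]
      apply Ideal.mem_map_of_mem
      fin_cases i
      · exact Ideal.sub_mem _ (hX _) (hX _)
      · exact Ideal.mul_mem_left _ _ (hX _)
      · exact Ideal.mul_mem_left _ _ (hX _)
      · exact Ideal.sub_mem _ (hX _) (hX _)
    intro r hr
    obtain ⟨p, hp, rfl⟩ := List.mem_map.1 hr
    rw [hι]
    simp only [List.mem_cons, List.not_mem_nil, or_false] at hp
    rcases hp with rfl | rfl | rfl | rfl <;> exact hav _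
  · exact aux_reg.of_faithfullyFlat
end

section
/- Let I⁻ ⊂ ℂ[x,y,z,w,p₁,p₂,p₃,p₄] be the ideal generated by xp₂, xp₁ + yp₂ − zp₃ − wp₄, yp₂, zp₄, zp₃, wp₄, yzp₁, xwp₃, together with xz, xw and zy. Then ℂ[x,y,z,w,p₁,p₂,p₃,p₄]/I⁻ has Krull dimension 4 and depth 4, hence is Cohen–Macaulay. -/
open MvPolynomial

theorem aux_len {R : Type*} [CommRing R] [IsNoetherianRing R] (rs : List R) :
    ∀ (M : Type _) [AddCommGroup M] [Module R M] [Module.Finite R M],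
    RingTheory.Sequence.IsRegular M rs → (rs.length : WithBot ℕ∞) ≤ Module.supportDim R M := by
  induction rs with
  | nil =>
    intro M _ _ _ h
    have := h.nontrivial
    have h2 : Module.supportDim R M ≠ ⊥ := Module.supportDim_ne_bot_of_nontrivial R M
    obtain ⟨n, hn⟩ := WithBot.ne_bot_iff_exists.mp h2
    rw [← hn]
    simp only [List.length_nil, Nat.cast_zero]
    exact_mod_cast (zero_le : 0 ≤ n)
  | cons r rs ih =>
    intro M _ _ _ h
    rw [RingTheory.Sequence.isRegular_cons_iff] at h
    have h1 := ih _ h.2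
    have h2 := Module.supportDim_quotSMulTop_succ_le_of_notMem_minimalPrimes (M := M) (x := r)
      (fun _ ↦ h.1.notMem_of_mem_minimalPrimes)
    refine le_trans ?_ h2
    simp only [List.length_cons, Nat.cast_add, Nat.cast_one]
    gcongr

theorem aux_dim_s6 {P Q : Type*} [CommRing P] [CommRing Q] [Algebra P Q] [Algebra.IsIntegral P Q] :
    ringKrullDim Q ≤ ringKrullDim P := by
  refine Order.krullDim_le_of_strictMono
    (fun p : PrimeSpectrum Q => PrimeSpectrum.comap (algebraMap P Q) p) ?_
  intro p q h
  exact Ideal.IsIntegral.comap_lt_comap (R := P) (I := p.asIdeal) (J := q.asIdeal) h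

theorem aux_X : RingTheory.Sequence.IsRegular (MvPolynomial (Fin 4) ℂ)
    [(X 0 : MvPolynomial (Fin 4) ℂ), X 1, X 2, X 3] := by
  have key : ∀ (s : Set (Fin 4)) (i : Fin 4) (I : Ideal (MvPolynomial (Fin 4) ℂ)),
      I = Ideal.span (X '' s) → i ∉ s →
      IsSMulRegular (MvPolynomial (Fin 4) ℂ ⧸ (I • ⊤ : Submodule (MvPolynomial (Fin 4) ℂ) (MvPolynomial (Fin 4) ℂ)))
        (X i : MvPolynomial (Fin 4) ℂ) := by
    intro s i I hI hi
    rw [isSMulRegular_iff_right_eq_zero_of_smul]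
    intro f
    obtain ⟨f, rfl⟩ := Submodule.mkQ_surjective _ f
    rw [← map_smul]
    simp only [Submodule.mkQ_apply, Submodule.Quotient.mk_eq_zero, smul_eq_mul, Ideal.mul_top]
    rw [hI, mem_ideal_span_X_image, mem_ideal_span_X_image]
    intro h m hm
    obtain ⟨j, hj, hj2⟩ := h (Finsupp.single i 1 + m) (by
      rw [mem_support_iff, coeff_X_mul]; exact mem_support_iff.mp hm)
    refine ⟨j, hj, ?_⟩
    have : i ≠ j := fun e => hi (e ▸ hj)
    simpa [Finsupp.single_apply, this] using hj2
  constructor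
  · constructor
    intro i hi
    simp only [List.length_cons, List.length_nil] at hi
    interval_cases i
    · exact key ∅ 0 _ (by simp) (by simp)
    · exact key {0} 1 _ (by simp [Ideal.ofList_singleton]) (by simp)
    · exact key {0, 1} 2 _ (by simp [Ideal.ofList_cons, Set.image_insert_eq, Ideal.span_insert]) (by simp)
    · exact key {0, 1, 2} 3 _ (by simp [Ideal.ofList_cons, Set.image_insert_eq, Ideal.span_insert]) (by simp)
  · intro h
    have h1 : (1 : MvPolynomial (Fin 4) ℂ) ∈ Ideal.span (X '' {0, 1, 2, 3} : Set (MvPolynomial (Fin 4) ℂ)) := by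
      have : (1 : MvPolynomial (Fin 4) ℂ) ∈ (⊤ : Submodule (MvPolynomial (Fin 4) ℂ) (MvPolynomial (Fin 4) ℂ)) := trivial
      rw [h] at this
      simpa [Ideal.ofList_cons, Set.image_insert_eq, Ideal.span_insert] using this
    rw [mem_ideal_span_X_image] at h1
    obtain ⟨j, _, hj⟩ := h1 0 (by simp [mem_support_iff])
    simp at hj

theorem aux_free {P Q : Type*} [CommRing P] [IsDomain P] [CommRing Q] [Algebra P Q]
    (t1 t2 t3 t4 : P) (h1 : t1 ≠ 0) (h2 : t2 ≠ 0) (h3 : t3 ≠ 0) (h4 : t4 ≠ 0)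
    (a1 a2 a3 a4 : Q)
    (r11 : a1 * a1 = algebraMap P Q t1 * a1)
    (r12 : a1 * a2 = algebraMap P Q t2 * a1)
    (r13 : a1 * a3 = algebraMap P Q t3 * a1)
    (r14 : a1 * a4 = algebraMap P Q t4 * a1)
    (r22 : a2 * a2 = algebraMap P Q t2 * a2)
    (r24 : a2 * a4 = algebraMap P Q t4 * a2)
    (r33 : a3 * a3 = algebraMap P Q t3 * a3)
    (r34 : a3 * a4 = algebraMap P Q t4 * a3)
    (r44 : a4 * a4 = algebraMap P Q t4 * a4)
    (gen : Algebra.adjoin P {a1, a2, a3, a4} = ⊤)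
    (e : ∀ s : Fin 6, ∃ f : Q →ₐ[P] P,
      ![f a1, f a2, f a3, f a4] = (![![0,0,0,0], ![0,0,0,t4], ![0,t2,0,t4], ![0,0,t3,t4],
        ![0,t2,t3,t4], ![t1,t2,t3,t4]] : Fin 6 → Fin 4 → P) s) :
    Module.Free P Q ∧ Module.Finite P Q := by
  let v : Fin 6 → Q := ![1, a1, a2, a3, a4, a2 * a3]
  have li : LinearIndependent P v := by
    rw [Fintype.linearIndependent_iff]
    intro g hg
    have ev : ∀ f : Q →ₐ[P] P, g 0 + g 1 * f a1 + g 2 * f a2 + g 3 * f a3 + g 4 * f a4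
        + g 5 * (f a2 * f a3) = 0 := by
      intro f
      have := congrArg f hg
      simpa [Fin.sum_univ_six, v] using this
    have ev2 : ∀ s : Fin 6, ∀ c : Fin 4 → P, c = (![![0,0,0,0], ![0,0,0,t4], ![0,t2,0,t4], ![0,0,t3,t4],
        ![0,t2,t3,t4], ![t1,t2,t3,t4]] : Fin 6 → Fin 4 → P) s →
        g 0 + g 1 * c 0 + g 2 * c 1 + g 3 * c 2 + g 4 * c 3
        + g 5 * (c 1 * c 2) = 0 := by
      intro s c hc
      obtain ⟨f, hf⟩ := e s
      rw [← hc] at hf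
      subst hf
      exact ev f
    have e0 := ev2 0 _ rfl
    have e1 := ev2 1 _ rfl
    have e2 := ev2 2 _ rfl
    have e3 := ev2 3 _ rfl
    have e4 := ev2 4 _ rfl
    have e5 := ev2 5 _ rfl
    simp at e0 e1 e2 e3 e4 e5
    have g0 : g 0 = 0 := e0
    have g4 : g 4 = 0 := by simpa [g0, h4] using e1
    have g2 : g 2 = 0 := by simpa [g0, g4, h2] using e2
    have g3 : g 3 = 0 := by simpa [g0, g4, h3] using e3
    have g5 : g 5 = 0 := by simpa [g0, g4, g2, g3, h2, h3] using e4
    have g1 : g 1 = 0 := by simpa [g0, g4, g2, g3, g5, h1] using e5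
    intro i
    fin_cases i <;> assumption
  have sp : ⊤ ≤ Submodule.span P (Set.range v) := by
    set N := Submodule.span P (Set.range v) with hN
    have hv : ∀ i, v i ∈ N := fun i => Submodule.subset_span ⟨i, rfl⟩
    have m0 : (1 : Q) ∈ N := hv 0
    have m1 : a1 ∈ N := hv 1
    have m2 : a2 ∈ N := hv 2
    have m3 : a3 ∈ N := hv 3
    have m4 : a4 ∈ N := hv 4
    have m5 : a2 * a3 ∈ N := hv 5
    have sm : ∀ (p : P) (q : Q), q ∈ N → algebraMap P Q p * q ∈ N := fun p q hq => by
      rw [← Algebra.smul_def]; exact N.smul_mem p hq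
    have mulc : ∀ a : Q, (∀ i, a * v i ∈ N) → ∀ q ∈ N, a * q ∈ N := by
      intro a ha q hq
      have : N ≤ N.comap (LinearMap.mulLeft P a) := by
        rw [hN, Submodule.span_le]
        rintro _ ⟨i, rfl⟩
        exact ha i
      exact this hq
    have c1 : ∀ q ∈ N, a1 * q ∈ N := by
      refine mulc a1 ?_
      intro i
      fin_cases i
      · simpa [v] using m1
      · change a1 * a1 ∈ N; rw [r11]; exact sm _ _ m1
      · change a1 * a2 ∈ N; rw [r12]; exact sm _ _ m1
      · change a1 * a3 ∈ N; rw [r13]; exact sm _ _ m1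
      · change a1 * a4 ∈ N; rw [r14]; exact sm _ _ m1
      · change a1 * (a2 * a3) ∈ N
        rw [← mul_assoc, r12, mul_assoc, r13]; exact sm _ _ (sm _ _ m1)
    have c2 : ∀ q ∈ N, a2 * q ∈ N := by
      refine mulc a2 ?_
      intro i
      fin_cases i
      · simpa [v] using m2
      · change a2 * a1 ∈ N; rw [mul_comm, r12]; exact sm _ _ m1
      · change a2 * a2 ∈ N; rw [r22]; exact sm _ _ m2
      · exact m5
      · change a2 * a4 ∈ N; rw [r24]; exact sm _ _ m2
      · change a2 * (a2 * a3) ∈ N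
        rw [← mul_assoc, r22, mul_assoc]; exact sm _ _ m5
    have c3 : ∀ q ∈ N, a3 * q ∈ N := by
      refine mulc a3 ?_
      intro i
      fin_cases i
      · simpa [v] using m3
      · change a3 * a1 ∈ N; rw [mul_comm, r13]; exact sm _ _ m1
      · change a3 * a2 ∈ N; rw [mul_comm]; exact m5
      · change a3 * a3 ∈ N; rw [r33]; exact sm _ _ m3
      · change a3 * a4 ∈ N; rw [r34]; exact sm _ _ m3
      · change a3 * (a2 * a3) ∈ N
        rw [mul_left_comm, r33, mul_left_comm]; exact sm _ _ m5
    have c4 : ∀ q ∈ N, a4 * q ∈ N := by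
      refine mulc a4 ?_
      intro i
      fin_cases i
      · simpa [v] using m4
      · change a4 * a1 ∈ N; rw [mul_comm, r14]; exact sm _ _ m1
      · change a4 * a2 ∈ N; rw [mul_comm, r24]; exact sm _ _ m2
      · change a4 * a3 ∈ N; rw [mul_comm, r34]; exact sm _ _ m3
      · change a4 * a4 ∈ N; rw [r44]; exact sm _ _ m4
      · change a4 * (a2 * a3) ∈ N
        rw [← mul_assoc, mul_comm a4, r24, mul_assoc]; exact sm _ _ m5
    have all : ∀ x ∈ Algebra.adjoin P {a1, a2, a3, a4}, ∀ q ∈ N, x * q ∈ N := by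
      intro x hx
      induction hx using Algebra.adjoin_induction with
      | mem x hx =>
        rcases hx with rfl | rfl | rfl | rfl
        · exact c1
        · exact c2
        · exact c3
        · exact c4
      | algebraMap r => exact fun q hq => sm r q hq
      | add x y _ _ hx hy => intro q hq; rw [add_mul]; exact N.add_mem (hx q hq) (hy q hq)
      | mul x y _ _ hx hy => intro q hq; rw [mul_assoc]; exact hx _ (hy q hq)
    intro x _
    have := all x (by rw [gen]; trivial) 1 m0
    simpa using this
  let b := Module.Basis.mk li sp
  exact ⟨Module.Free.of_basis b, Module.Finite.of_basis b⟩

set_option maxHeartbeats 2000000 in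
theorem stmt6 (Iminus : Ideal (MvPolynomial (Fin 8) ℂ))
    (hI : Iminus = Ideal.span
      { X 0 * X 5,                                   -- xp₂
        X 0 * X 4 + X 1 * X 5 - X 2 * X 6 - X 3 * X 7,  -- xp₁ + yp₂ − zp₃ − wp₄
        X 1 * X 5,                                   -- yp₂
        X 2 * X 7,                                   -- zp₄
        X 2 * X 6,                                   -- zp₃
        X 3 * X 7,                                   -- wp₄
        X 1 * X 2 * X 4,                             -- yzp₁
        X 0 * X 3 * X 6,                             -- xwp₃
        X 0 * X 2,                                   -- xz
        X 0 * X 3,                                   -- xw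
        X 2 * X 1 }) :                               -- zy
    -- Krull dimension 4 …
    ringKrullDim (MvPolynomial (Fin 8) ℂ ⧸ Iminus) = 4 ∧
    -- … depth ≥ 4: a regular sequence of length 4 inside the maximal ideal …
    (∃ rs : List (MvPolynomial (Fin 8) ℂ ⧸ Iminus),
      rs.length = 4 ∧
      (∀ r ∈ rs, r ∈ Ideal.map (Ideal.Quotient.mk Iminus)
          (Ideal.span (Set.range (X : Fin 8 → MvPolynomial (Fin 8) ℂ)))) ∧
      RingTheory.Sequence.IsRegular (MvPolynomial (Fin 8) ℂ ⧸ Iminus) rs) ∧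
    -- … and depth ≤ 4: no regular sequence of length 5 inside the maximal ideal
    ¬ (∃ rs : List (MvPolynomial (Fin 8) ℂ ⧸ Iminus),
      rs.length = 5 ∧
      (∀ r ∈ rs, r ∈ Ideal.map (Ideal.Quotient.mk Iminus)
          (Ideal.span (Set.range (X : Fin 8 → MvPolynomial (Fin 8) ℂ)))) ∧
      RingTheory.Sequence.IsRegular (MvPolynomial (Fin 8) ℂ ⧸ Iminus) rs) := by
  have hmem : ∀ g ∈ ({X 0 * X 5, X 0 * X 4, X 1 * X 5, X 2 * X 7, X 2 * X 6, X 3 * X 7,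
      X 0 * X 2, X 0 * X 3, X 2 * X 1} : Set (MvPolynomial (Fin 8) ℂ)), g ∈ Iminus := by
    have hs : ∀ g ∈ _, g ∈ Iminus := fun g hg => by rw [hI]; exact Ideal.subset_span hg
    have h1 := hs (X 0 * X 4 + X 1 * X 5 - X 2 * X 6 - X 3 * X 7) (by simp)
    have h2 := hs (X 1 * X 5) (by simp)
    have h3 := hs (X 2 * X 6) (by simp)
    have h4 := hs (X 3 * X 7) (by simp)
    rintro g (rfl | rfl | rfl | rfl | rfl | rfl | rfl | rfl | rfl)
    · exact hs _ (by simp)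
    · have := Iminus.add_mem (Iminus.add_mem (Iminus.sub_mem h1 h2) h3) h4
      convert this using 1
      ring
    all_goals exact hs _ (by simp)
  let Q := MvPolynomial (Fin 8) ℂ ⧸ Iminus
  let P := MvPolynomial (Fin 4) ℂ
  let mk : MvPolynomial (Fin 8) ℂ →+* Q := Ideal.Quotient.mk Iminus
  let x : Fin 8 → Q := fun i => mk (X i)
  have z : ∀ i j : Fin 8, (X i * X j : MvPolynomial (Fin 8) ℂ) ∈ Iminus → x i * x j = 0 := by
    intro i j h
    change mk (X i) * mk (X j) = 0
    rw [← map_mul]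
    exact Ideal.Quotient.eq_zero_iff_mem.mpr h
  have z05 := z 0 5 (hmem _ (by simp))
  have z04 := z 0 4 (hmem _ (by simp))
  have z15 := z 1 5 (hmem _ (by simp))
  have z27 := z 2 7 (hmem _ (by simp))
  have z26 := z 2 6 (hmem _ (by simp))
  have z37 := z 3 7 (hmem _ (by simp))
  have z02 := z 0 2 (hmem _ (by simp))
  have z03 := z 0 3 (hmem _ (by simp))
  have z21 := z 2 1 (hmem _ (by simp))
  let τ : Fin 4 → MvPolynomial (Fin 8) ℂ := ![X 0 - X 4, X 1 - X 5, X 7 - X 3, X 6 - X 2]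
  let φ : P →+* Q := mk.comp (aeval τ : P →ₐ[ℂ] MvPolynomial (Fin 8) ℂ).toRingHom
  letI alg : Algebra P Q := φ.toAlgebra
  have hφ : ∀ p, algebraMap P Q p = mk (aeval τ p) := fun p => rfl
  have a0 : algebraMap P Q (X 0) = x 0 - x 4 := by rw [hφ, aeval_X]; simp [τ, x]
  have a1 : algebraMap P Q (X 1) = x 1 - x 5 := by rw [hφ, aeval_X]; simp [τ, x]
  have a2 : algebraMap P Q (X 2) = x 7 - x 3 := by rw [hφ, aeval_X]; simp [τ, x]
  have a3 : algebraMap P Q (X 3) = x 6 - x 2 := by rw [hφ, aeval_X]; simp [τ, x]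
  have aC : ∀ c, algebraMap P Q (C c) = mk (C c) := by
    intro c; rw [hφ, aeval_C]; rfl
  have gen : Algebra.adjoin P {x 0, x 1, x 7, x 6} = ⊤ := by
    rw [eq_top_iff]
    set A := Algebra.adjoin P {x 0, x 1, x 7, x 6} with hA
    have s0 : x 0 ∈ A := Algebra.subset_adjoin (by simp)
    have s1 : x 1 ∈ A := Algebra.subset_adjoin (by simp)
    have s7 : x 7 ∈ A := Algebra.subset_adjoin (by simp)
    have s6 : x 6 ∈ A := Algebra.subset_adjoin (by simp)
    have s4 : x 4 ∈ A := by
      have := A.sub_mem s0 (A.algebraMap_mem (X 0)); rw [a0] at this; simpa using this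
    have s5 : x 5 ∈ A := by
      have := A.sub_mem s1 (A.algebraMap_mem (X 1)); rw [a1] at this; simpa using this
    have s3 : x 3 ∈ A := by
      have := A.sub_mem s7 (A.algebraMap_mem (X 2)); rw [a2] at this; simpa using this
    have s2 : x 2 ∈ A := by
      have := A.sub_mem s6 (A.algebraMap_mem (X 3)); rw [a3] at this; simpa using this
    have sx : ∀ i, x i ∈ A := by
      intro i; fin_cases i <;> assumption
    intro q _
    obtain ⟨p, rfl⟩ := Ideal.Quotient.mk_surjective q
    change mk p ∈ A
    induction p using MvPolynomial.induction_on with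
    | C c => rw [← aC]; exact A.algebraMap_mem _
    | add p q hp hq => rw [map_add]; exact A.add_mem (hp trivial) (hq trivial)
    | mul_X p i hp => rw [map_mul]; exact A.mul_mem (hp trivial) (sx i)
  have ev : ∀ c : Fin 8 → P, (c 0 * c 5 = 0 ∧ c 0 * c 4 = 0 ∧ c 1 * c 5 = 0 ∧ c 2 * c 7 = 0 ∧
      c 2 * c 6 = 0 ∧ c 3 * c 7 = 0 ∧ c 0 * c 2 = 0 ∧ c 0 * c 3 = 0 ∧ c 2 * c 1 = 0) →
      (c 0 - c 4 = X 0 ∧ c 1 - c 5 = X 1 ∧ c 7 - c 3 = X 2 ∧ c 6 - c 2 = X 3) →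
      ∃ f : Q →ₐ[P] P, ∀ i, f (x i) = c i := by
    rintro c ⟨k05, k04, k15, k27, k26, k37, k02, k03, k21⟩ ⟨l0, l1, l2, l3⟩
    have hk : ∀ g ∈ Iminus, (aeval c : MvPolynomial (Fin 8) ℂ →ₐ[ℂ] P).toRingHom g = 0 := by
      intro g hg
      have : Iminus ≤ RingHom.ker (aeval c : MvPolynomial (Fin 8) ℂ →ₐ[ℂ] P).toRingHom := by
        rw [hI, Ideal.span_le]
        rintro g (rfl | rfl | rfl | rfl | rfl | rfl | rfl | rfl | rfl | rfl | rfl) <;>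
          simp [RingHom.mem_ker, k05, k04, k15, k27, k26, k37, k02, k03, k21]
        exact Or.inl (mul_eq_zero.mp k21).symm
      exact this hg
    let f : Q →+* P := Ideal.Quotient.lift Iminus _ hk
    have hf : ∀ p, f (mk p) = aeval c p := fun p => rfl
    have hfx : ∀ i, f (x i) = c i := fun i => by
      change f (mk (X i)) = _; rw [hf, aeval_X]
    have hX0 : f (algebraMap P Q (X 0)) = X 0 := by rw [a0, map_sub, hfx, hfx, l0]
    have hX1 : f (algebraMap P Q (X 1)) = X 1 := by rw [a1, map_sub, hfx, hfx, l1]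
    have hX2 : f (algebraMap P Q (X 2)) = X 2 := by rw [a2, map_sub, hfx, hfx, l2]
    have hX3 : f (algebraMap P Q (X 3)) = X 3 := by rw [a3, map_sub, hfx, hfx, l3]
    have hX : ∀ i : Fin 4, f (algebraMap P Q (X i)) = X i := by
      intro i
      match i with
      | 0 => exact hX0
      | 1 => exact hX1
      | 2 => exact hX2
      | 3 => exact hX3
    refine ⟨{ f with commutes' := ?_ }, hfx⟩
    intro p
    change f (algebraMap P Q p) = p
    induction p using MvPolynomial.induction_on with
    | C r => rw [aC, hf, aeval_C]; rfl
    | add p q hp hq => rw [map_add, map_add, hp, hq]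
    | mul_X p i hp =>
      rw [map_mul, map_mul, hp, hX]
  have ev' : ∀ s : Fin 6, ∃ f : Q →ₐ[P] P,
      ![f (x 0), f (x 1), f (x 7), f (x 6)] = (![![0,0,0,0], ![0,0,0,X 3], ![0,X 1,0,X 3],
        ![0,0,X 2,X 3], ![0,X 1,X 2,X 3], ![X 0,X 1,X 2,X 3]] : Fin 6 → Fin 4 → P) s := by
    intro s
    fin_cases s
    · obtain ⟨f, hf⟩ := ev ![0, 0, -X 3, -X 2, -X 0, -X 1, 0, 0] (by simp) (by simp)
      exact ⟨f, by simp [hf]⟩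
    · obtain ⟨f, hf⟩ := ev ![0, 0, 0, -X 2, -X 0, -X 1, X 3, 0] (by simp) (by simp)
      exact ⟨f, by simp [hf]⟩
    · obtain ⟨f, hf⟩ := ev ![0, X 1, 0, -X 2, -X 0, 0, X 3, 0] (by simp) (by simp)
      exact ⟨f, by simp [hf]⟩
    · obtain ⟨f, hf⟩ := ev ![0, 0, 0, 0, -X 0, -X 1, X 3, X 2] (by simp) (by simp)
      exact ⟨f, by simp [hf]⟩
    · obtain ⟨f, hf⟩ := ev ![0, X 1, 0, 0, -X 0, 0, X 3, X 2] (by simp) (by simp)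
      exact ⟨f, by simp [hf]⟩
    · obtain ⟨f, hf⟩ := ev ![X 0, X 1, 0, 0, 0, 0, X 3, X 2] (by simp) (by simp)
      exact ⟨f, by simp [hf]⟩
  obtain ⟨hfree, hfin⟩ := aux_free (P := P) (Q := Q) (X 0) (X 1) (X 2) (X 3)
    (X_ne_zero _) (X_ne_zero _) (X_ne_zero _) (X_ne_zero _) (x 0) (x 1) (x 7) (x 6)
    (by rw [a0]; linear_combination z04) (by rw [a1]; linear_combination z05)
    (by rw [a2]; linear_combination z03) (by rw [a3]; linear_combination z02)
    (by rw [a1]; linear_combination z15) (by rw [a3]; linear_combination z21)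
    (by rw [a2]; linear_combination z37) (by rw [a3]; linear_combination z27)
    (by rw [a3]; linear_combination z26) gen ev'
  haveI : Nontrivial Q := by
    obtain ⟨f, _⟩ := ev' 0
    exact f.toRingHom.domain_nontrivial
  have hle : ringKrullDim Q ≤ 4 := by
    refine (aux_dim_s6 (P := P) (Q := Q)).trans ?_
    rw [MvPolynomial.ringKrullDim_of_isNoetherianRing]
    simp
  have hreg : RingTheory.Sequence.IsRegular Q
      ([(X 0 : P), X 1, X 2, X 3].map (algebraMap P Q)) := aux_X.of_faithfullyFlat
  have hlen : ∀ rs : List Q, RingTheory.Sequence.IsRegular Q rs →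
      (rs.length : WithBot ℕ∞) ≤ ringKrullDim Q := by
    intro rs h
    rw [← Module.supportDim_self_eq_ringKrullDim]
    exact aux_len rs Q h
  refine ⟨le_antisymm hle (hlen _ hreg), ⟨_, by simp, ?_, hreg⟩, ?_⟩
  · have hx : ∀ i, x i ∈ Ideal.map (Ideal.Quotient.mk Iminus)
          (Ideal.span (Set.range (X : Fin 8 → MvPolynomial (Fin 8) ℂ))) := fun i =>
      Ideal.mem_map_of_mem _ (Ideal.subset_span ⟨i, rfl⟩)
    simp only [List.map_cons, List.map_nil, a0, a1, a2, a3]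
    intro r hr
    simp only [List.mem_cons, List.not_mem_nil, or_false] at hr
    rcases hr with rfl | rfl | rfl | rfl <;> exact Ideal.sub_mem _ (hx _) (hx _)
  · rintro ⟨rs, h5, _, h⟩
    have h' := (hlen rs h).trans hle
    rw [h5] at h'
    have h'' : (5 : ℕ) ≤ (4 : ℕ) := by exact_mod_cast h'
    omega
end
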